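/- Let 1 ≤ t ≤ r ≤ s and let H be a hereditary family with μ(H) ≥ c(r,s,t) where c(r,s,t) = r + (s−t)·max{2·C(s,t), 2^r·(r−t)·C(r,t)+1}. If A is a non-empty subfamily of H^(r), B is a non-empty subfamily of H^(s), A and B are cross-t-intersecting, and |A| + |B| is maximum under these conditions, then there exists a set I ∈ H with t ≤ |I| ≤ r such that either A = {A ∈ H^(r) : I ⊆ A} and B = {B ∈ H^(s) : |B ∩ I| ≥ t}, or r = s, t < |I|, A = {A ∈ H^(r) : |A ∩ I| ≥ t}, and B = {B ∈ H^(s) : I ⊆ B}. -/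

import Mathlib

def Hereditary {α : Type*} [DecidableEq α] (F : Finset (Finset α)) : Prop :=
  ∀ A ∈ F, ∀ B ⊆ A, B ∈ F

noncomputable def mu {α : Type*} [DecidableEq α] (F : Finset (Finset α)) : ℕ :=
  sInf {n | ∃ B ∈ F, (∀ A ∈ F, ¬ B ⊂ A) ∧ B.card = n}

def cBound (r s t : ℕ) : ℕ :=
  r + (s - t) * max (2 * Nat.choose s t) (2 ^ r * (r - t) * Nat.choose r t + 1)

theorem ch14 (s : ℕ) : ∀ t, 1 ≤ t → t < s → s ≤ s.choose t := by
  induction s with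
  | zero => intro t _ h; omega
  | succ s ih =>
    intro t h1 h2
    obtain ⟨k, rfl⟩ : ∃ k, t = k + 1 := ⟨t - 1, by omega⟩
    rcases Nat.eq_or_lt_of_le (show k + 1 ≤ s by omega) with h | h
    · rw [h, Nat.choose_succ_self_right]
    · have h3 := ih (k + 1) h1 h
      have h4 : 0 < s.choose k := Nat.choose_pos (by omega)
      rw [Nat.choose_succ_succ']
      omega

def star14 {α : Type*} [DecidableEq α] (H : Finset (Finset α)) (k : ℕ) (T : Finset α) :
    Finset (Finset α) := H.filter (fun S => S.card = k ∧ T ⊆ S)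

theorem mem_star14 {α : Type*} [DecidableEq α] {H : Finset (Finset α)} {k : ℕ} {T S : Finset α} :
    S ∈ star14 H k T ↔ S ∈ H ∧ S.card = k ∧ T ⊆ S := by
  simp [star14]

theorem ext14 {α : Type*} [DecidableEq α] (H : Finset (Finset α)) (S : Finset α) (hS : S ∈ H) :
    ∃ C ∈ H, S ⊆ C ∧ mu H ≤ C.card := by
  obtain ⟨C, hSC, hC⟩ := H.exists_le_maximal hS
  refine ⟨C, hC.1, hSC, Nat.sInf_le ⟨C, hC.1, ?_, rfl⟩⟩
  intro D hD h
  exact hC.not_gt hD h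

theorem dc14 {α : Type*} [DecidableEq α] (H : Finset (Finset α)) (hH : Hereditary H)
    (j : ℕ) (T : Finset α) :
    (star14 H j T).card * (mu H - j) ≤ (star14 H (j+1) T).card * (j + 1 - T.card) := by
  apply Finset.card_mul_le_card_mul (fun S S' : Finset α => S ⊆ S')
  · intro S hS
    obtain ⟨hSH, hSc, hTS⟩ := mem_star14.1 hS
    obtain ⟨C, hC, hSC, hmu⟩ := ext14 H S hSH
    have h1 : ((C \ S).image (fun x => insert x S)).card = C.card - S.card := by
      rw [Finset.card_image_of_injOn, Finset.card_sdiff_of_subset hSC]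
      intro x hx y hy hxy
      simp only [Finset.coe_sdiff, Set.mem_sdiff, Finset.mem_coe] at hx hy
      have : x ∈ insert y S := by
        have h : insert x S = insert y S := hxy
        rw [← h]; simp
      rcases Finset.mem_insert.1 this with h | h
      · exact h
      · exact absurd h hx.2
    calc mu H - j ≤ C.card - S.card := by omega
      _ = _ := h1.symm
      _ ≤ _ := by
        apply Finset.card_le_card
        intro S' hS'
        obtain ⟨x, hx, rfl⟩ := Finset.mem_image.1 hS'
        rw [Finset.mem_sdiff] at hx
        rw [Finset.mem_bipartiteAbove]
        refine ⟨mem_star14.2 ⟨hH C hC _ (Finset.insert_subset hx.1 hSC), ?_, ?_⟩, ?_⟩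
        · rw [Finset.card_insert_of_notMem hx.2, hSc]
        · exact hTS.trans (Finset.subset_insert _ _)
        · exact Finset.subset_insert _ _
  · intro S' hS'
    obtain ⟨hSH, hSc, hTS⟩ := mem_star14.1 hS'
    calc _ ≤ ((S' \ T).image (fun x => S'.erase x)).card := by
          apply Finset.card_le_card
          intro S hS
          rw [Finset.mem_bipartiteBelow] at hS
          obtain ⟨h1, h2⟩ := hS
          obtain ⟨_, h3, h4⟩ := mem_star14.1 h1
          have h5 : (S' \ S).card = 1 := by
            rw [Finset.card_sdiff_of_subset h2]; omega
          obtain ⟨x, hx⟩ := Finset.card_eq_one.1 h5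
          have hx' : x ∈ S' \ S := by rw [hx]; simp
          rw [Finset.mem_sdiff] at hx'
          refine Finset.mem_image.2 ⟨x, Finset.mem_sdiff.2 ⟨hx'.1, fun h => hx'.2 (h4 h)⟩, ?_⟩
          rw [Finset.erase_eq, ← hx, Finset.sdiff_sdiff_eq_self h2]
      _ ≤ (S' \ T).card := Finset.card_image_le
      _ = j + 1 - T.card := by rw [Finset.card_sdiff_of_subset hTS, hSc]

theorem er14 {α : Type*} [DecidableEq α] (H : Finset (Finset α)) (hH : Hereditary H)
    (j : ℕ) (T : Finset α) (z : α) (hz : z ∉ T) :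
    (star14 H (j+1) (insert z T)).card ≤ (star14 H j T).card := by
  apply Finset.card_le_card_of_injOn (fun S => S.erase z)
  · intro S hS
    obtain ⟨hSH, hSc, hTS⟩ := mem_star14.1 (Finset.mem_coe.1 hS)
    have hzS : z ∈ S := hTS (Finset.mem_insert_self _ _)
    apply Finset.mem_coe.2
    refine mem_star14.2 ⟨hH S hSH _ (Finset.erase_subset _ _), ?_, ?_⟩
    · rw [Finset.card_erase_of_mem hzS]; omega
    · intro x hx
      exact Finset.mem_erase.2 ⟨fun h => hz (h ▸ hx), hTS (Finset.mem_insert_of_mem hx)⟩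
  · intro S hS S' hS' h
    obtain ⟨_, _, hTS⟩ := mem_star14.1 (Finset.mem_coe.1 hS)
    obtain ⟨_, _, hTS'⟩ := mem_star14.1 (Finset.mem_coe.1 hS')
    have h' : S.erase z = S'.erase z := h
    rw [← Finset.insert_erase (hTS (Finset.mem_insert_self _ _)), h',
      Finset.insert_erase (hTS' (Finset.mem_insert_self _ _))]

/-- monotone -/
theorem mono14 {α : Type*} [DecidableEq α] (H : Finset (Finset α)) (hH : Hereditary H)
    (t r s M : ℕ) (htr : t ≤ r) (hts : t < s) (hM : 2 ≤ M)
    (hmu : r + (s - t) * M ≤ mu H) (T : Finset α) (hT : T.card = t) (j : ℕ) (hjs : j ≤ s) :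
    (star14 H j T).card ≤ (star14 H s T).card := by
  induction hjs using Nat.decreasingInduction with
  | self => exact le_rfl
  | of_succ k hk ih =>
    refine le_trans ?_ ih
    have h := dc14 H hH k T
    rw [hT] at h
    obtain ⟨d, rfl⟩ : ∃ d, s = t + d := ⟨s - t, by omega⟩
    have h3 : d * 2 ≤ d * M := Nat.mul_le_mul_left _ hM
    have e : t + d - t = d := by omega
    rw [e] at hmu
    have h2 : k + 1 - t ≤ mu H - k := by omega
    have h4 : 0 < mu H - k := by omega
    have h5 := h.trans (Nat.mul_le_mul_left _ h2)
    exact Nat.le_of_mul_le_mul_right h5 h4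

theorem K14 {α : Type*} [DecidableEq α] (H : Finset (Finset α)) (hH : Hereditary H)
    (t r s M : ℕ) (htr : t ≤ r) (hts : t < s) (hM : 2 ≤ M)
    (hmu : r + (s - t) * M ≤ mu H) (T : Finset α) (hT : T.card = t) (j : ℕ) (hjr : j ≤ r)
    (hjs : j < s) :
    M * (star14 H j T).card ≤ (star14 H s T).card := by
  refine le_trans ?_ (mono14 H hH t r s M htr hts hM hmu T hT (j+1) hjs)
  have h := dc14 H hH j T
  rw [hT] at h
  have h1 : (s - t) * M ≤ mu H - j := by omega
  have h2 : j + 1 - t ≤ s - t := by omega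
  have h3 := (Nat.mul_le_mul_left (star14 H j T).card h1).trans
    (h.trans (Nat.mul_le_mul_left _ h2))
  have h4 : 0 < s - t := by omega
  apply Nat.le_of_mul_le_mul_right _ h4
  calc _ = (star14 H j T).card * ((s - t) * M) := by ring
    _ ≤ _ := h3

theorem E14 {α : Type*} [DecidableEq α] (H : Finset (Finset α)) (hH : Hereditary H)
    (t r s M : ℕ) (htr : t ≤ r) (hts : t < s)
    (hmu : r + (s - t) * (M + 1) ≤ mu H) (T : Finset α) (hT : T.card = t)
    (z : α) (hz : z ∉ T) (hpos : 0 < (star14 H s T).card) :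
    M * (star14 H s (insert z T)).card < (star14 H s T).card := by
  obtain ⟨k, rfl⟩ : ∃ k, s = k + 1 := ⟨s - 1, by omega⟩
  have h := dc14 H hH k T
  have h0 := er14 H hH k T z hz
  rw [hT] at h
  set e := (star14 H (k+1) (insert z T)).card
  set a := (star14 H (k+1) T).card
  have h1 : (k + 1 - t) * M + 1 ≤ mu H - k := by
    have : (k + 1 - t) * (M + 1) = (k+1-t) * M + (k + 1 - t) := by ring
    omega
  have h2 : e * ((k + 1 - t) * M + 1) ≤ a * (k + 1 - t) :=
    (Nat.mul_le_mul h0 h1).trans h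
  have h4 : 0 < k + 1 - t := by omega
  rcases Nat.eq_zero_or_pos e with he | he
  · rw [he]; simpa using hpos
  · apply Nat.lt_of_mul_lt_mul_right (a := k + 1 - t)
    calc M * e * (k + 1 - t) < e * ((k + 1 - t) * M + 1) := by
          have : e * ((k + 1 - t) * M + 1) = M * e * (k + 1 - t) + e := by ring
          omega
      _ ≤ _ := h2

theorem step1_14 {α : Type*} [DecidableEq α] (t r s N m : ℕ)
    (htr : t ≤ r)
    (H : Finset (Finset α)) (A B : Finset (Finset α))
    (hA : ∀ X ∈ A, X ∈ H ∧ X.card = r) (hB : ∀ X ∈ B, X ∈ H ∧ X.card = s)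
    (hcross : ∀ A' ∈ A, ∀ B' ∈ B, t ≤ (A' ∩ B').card)
    (hN : 2 * (r.choose t * (r - t + 1)) ≤ N)
    (hE : ∀ T : Finset α, T.card = t → ∀ z ∉ T, N * (star14 H s (insert z T)).card < m)
    (hBm : m ≤ 2 * B.card) (A1 : Finset α) (hA1 : A1 ∈ A) :
    ∃ T, T.card = t ∧ ∀ X ∈ A, T ⊆ X := by
  by_contra! hcon
  have hY : ∀ T : Finset α, ∃ Y : Finset α, T.card = t → Y.card = r - t + 1 ∧ Disjoint Y T ∧
      ∀ S ∈ B, ∃ z ∈ Y, z ∈ S := by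
    intro T
    by_cases hT : T.card = t
    · obtain ⟨X, hX, hTX⟩ := hcon T hT
      have h1 : (X ∩ T).card < t := by
        rw [← hT]
        apply Finset.card_lt_card
        refine ⟨Finset.inter_subset_right, fun h => hTX (h.trans Finset.inter_subset_left)⟩
      have h2 : (X \ T).card + (X ∩ T).card = X.card := Finset.card_sdiff_add_card_inter X T
      have h3 := (hA X hX).2
      obtain ⟨Y, hY, hYc⟩ := Finset.exists_subset_card_eq (s := X \ T) (n := r - t + 1) (by omega)
      refine ⟨Y, fun _ => ⟨hYc, ?_, ?_⟩⟩
      · rw [Finset.disjoint_left]; intro z hz; exact (Finset.mem_sdiff.1 (hY hz)).2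
      · intro S hS
        by_contra! hd
        have h4 := hcross X hX S hS
        have h5 : X ∩ S ⊆ X \ Y := by
          intro z hz
          rw [Finset.mem_inter] at hz
          exact Finset.mem_sdiff.2 ⟨hz.1, fun h => hd z h hz.2⟩
        have h6 := Finset.card_le_card h5
        rw [Finset.card_sdiff_of_subset (hY.trans Finset.sdiff_subset)] at h6
        omega
    · exact ⟨∅, fun h => absurd h hT⟩
  choose Y hY using hY
  have hsub : B ⊆ (A1.powersetCard t).biUnion (fun T => (Y T).biUnion
      (fun z => star14 H s (insert z T))) := by
    intro S hS
    obtain ⟨T, hT, hTc⟩ := Finset.exists_subset_card_eq (hcross A1 hA1 S hS)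
    obtain ⟨_, _, h3⟩ := hY T hTc
    obtain ⟨z, hz, hzS⟩ := h3 S hS
    simp only [Finset.mem_biUnion]
    refine ⟨T, Finset.mem_powersetCard.2 ⟨hT.trans Finset.inter_subset_left, hTc⟩, z, hz,
      mem_star14.2 ⟨(hB S hS).1, (hB S hS).2, Finset.insert_subset hzS (hT.trans Finset.inter_subset_right)⟩⟩
  have hm : 0 < m := by
    by_contra h0
    obtain ⟨T, hT⟩ := Finset.exists_subset_card_eq (s := A1) (n := t) (by rw [(hA A1 hA1).2]; exact htr)
    obtain ⟨h1, h2, _⟩ := hY T hT.2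
    have : (Y T).Nonempty := by rw [← Finset.card_pos]; omega
    obtain ⟨z, hz⟩ := this
    have := hE T hT.2 z (Finset.disjoint_left.1 h2 hz)
    omega
  have hcard := (Finset.card_le_card hsub).trans Finset.card_biUnion_le
  have hb : N * B.card < r.choose t * (r - t + 1) * m := by
    have hlt : ∀ T ∈ A1.powersetCard t, N * ((Y T).biUnion
      (fun z => star14 H s (insert z T))).card < (r - t + 1) * m := by
      intro T hT
      have hTc := (Finset.mem_powersetCard.1 hT).2
      obtain ⟨h1, h2, _⟩ := hY T hTc
      calc _ ≤ N * ∑ z ∈ Y T, (star14 H s (insert z T)).card :=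
            Nat.mul_le_mul_left _ Finset.card_biUnion_le
        _ = ∑ z ∈ Y T, N * (star14 H s (insert z T)).card := Finset.mul_sum _ _ _
        _ < ∑ z ∈ Y T, m := by
            apply Finset.sum_lt_sum_of_nonempty
            · rw [← Finset.card_pos]; omega
            · intro z hz
              exact hE T hTc z (Finset.disjoint_left.1 h2 hz)
        _ = _ := by rw [Finset.sum_const, h1, smul_eq_mul]
    calc _ ≤ N * ∑ T ∈ A1.powersetCard t, _ := Nat.mul_le_mul_left _ hcard
      _ = ∑ T ∈ A1.powersetCard t, N * _ := Finset.mul_sum _ _ _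
      _ < ∑ T ∈ A1.powersetCard t, (r - t + 1) * m := by
          apply Finset.sum_lt_sum_of_nonempty _ hlt
          rw [Finset.powersetCard_nonempty, (hA A1 hA1).2]; exact htr
      _ = _ := by
          rw [Finset.sum_const, Finset.card_powersetCard, (hA A1 hA1).2, smul_eq_mul]; ring
  have h1 : N * m ≤ N * (2 * B.card) := Nat.mul_le_mul_left _ hBm
  have h2 : 2 * (r.choose t * (r - t + 1)) * m ≤ N * m := Nat.mul_le_mul_right _ hN
  nlinarith

theorem step2_14 {α : Type*} [DecidableEq α] (t r s N : ℕ)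
    (ht : 1 ≤ t) (htr : t < r)
    (H : Finset (Finset α)) (A B : Finset (Finset α)) (hAne : A.Nonempty)
    (hA : ∀ X ∈ A, X ∈ H ∧ X.card = r) (hB : ∀ X ∈ B, X ∈ H ∧ X.card = s)
    (hcross : ∀ A' ∈ A, ∀ B' ∈ B, t ≤ (A' ∩ B').card)
    (hN : 4 * (r - t) ≤ N) (hNs : 2 * s ≤ N + 1)
    (hE : ∀ T : Finset α, T.card = t → 0 < (star14 H s T).card → ∀ z ∉ T,
      N * (star14 H s (insert z T)).card < (star14 H s T).card)
    (hK : ∀ T : Finset α, T.card = t → ∀ z ∉ T,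
      (N + 1) * (star14 H r (insert z T)).card ≤ (star14 H s T).card)
    (hmax : ∀ X ∈ A, 1 + (H.filter (fun S => S.card = s ∧ t ≤ (S ∩ X).card)).card
      ≤ A.card + B.card)
    (I : Finset α) (hI : ∀ x, x ∈ I ↔ ∀ X ∈ A, x ∈ X) (hIt : t ≤ I.card) :
    ∀ S ∈ B, t ≤ (S ∩ I).card := by
  intro S hS
  by_contra! hlt
  have hIX : ∀ X ∈ A, I ⊆ X := fun X hX x hx => (hI x).1 hx X hX
  have hcov : ∀ X ∈ A, ∃ y ∈ S \ I, y ∈ X := by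
    intro X hX
    by_contra! hc
    have h1 := hcross X hX S hS
    have h2 : X ∩ S ⊆ S ∩ I := by
      intro y hy
      rw [Finset.mem_inter] at hy ⊢
      refine ⟨hy.2, ?_⟩
      by_contra h
      exact hc y (Finset.mem_sdiff.2 ⟨hy.2, h⟩) hy.1
    have := Finset.card_le_card h2
    omega
  have hSne : (S \ I).Nonempty := by
    obtain ⟨X, hX⟩ := hAne
    obtain ⟨y, hy, _⟩ := hcov X hX
    exact ⟨y, hy⟩
  obtain ⟨y, hy, hymax⟩ := Finset.exists_max_image (S \ I) (fun y => (A.filter (fun X => y ∈ X)).card) hSne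
  have hAle : A.card ≤ s * (A.filter (fun X => y ∈ X)).card := by
    calc A.card ≤ ((S \ I).biUnion (fun y => A.filter (fun X => y ∈ X))).card := by
          apply Finset.card_le_card
          intro X hX
          obtain ⟨y, hy, hyX⟩ := hcov X hX
          exact Finset.mem_biUnion.2 ⟨y, hy, Finset.mem_filter.2 ⟨hX, hyX⟩⟩
      _ ≤ (S \ I).card * _ := Finset.card_biUnion_le_card_mul _ _ _ hymax
      _ ≤ _ := by
          apply Nat.mul_le_mul_right
          rw [← (hB S hS).2]
          exact Finset.card_le_card Finset.sdiff_subset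
  have hApos : 0 < A.card := Finset.card_pos.2 hAne
  obtain ⟨A1, hA1⟩ : (A.filter (fun X => y ∈ X)).Nonempty := by
    rw [← Finset.card_pos]
    by_contra h
    have : (A.filter (fun X => y ∈ X)).card = 0 := by omega
    rw [this] at hAle
    omega
  obtain ⟨hA1, hyA1⟩ := Finset.mem_filter.1 hA1
  have hyI : y ∉ I := (Finset.mem_sdiff.1 hy).2
  obtain ⟨A2, hA2, hyA2⟩ : ∃ X ∈ A, y ∉ X := by
    by_contra! h
    exact hyI ((hI y).2 h)
  obtain ⟨T0, hT0, hT0c⟩ := Finset.exists_subset_card_eq (s := I) (n := t - 1) (by omega)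
  obtain ⟨z, hzI, hzT0⟩ : ∃ z ∈ I, z ∉ T0 := by
    by_contra! h
    have := Finset.card_le_card (show I ⊆ T0 from h)
    omega
  have hyT0 : y ∉ T0 := fun h => hyI (hT0 h)
  set T := insert y T0 with hTdef
  have hTc : T.card = t := by
    rw [hTdef, Finset.card_insert_of_notMem hyT0]; omega
  have hzT : z ∉ T := by
    intro h
    rcases Finset.mem_insert.1 h with h | h
    · exact hyI (h ▸ hzI)
    · exact hzT0 h
  have hTA1 : T ⊆ A1 := Finset.insert_subset hyA1 (hT0.trans (hIX A1 hA1))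
  have ha : (A.filter (fun X => y ∈ X)).card ≤ (star14 H r (insert z T)).card := by
    apply Finset.card_le_card
    intro X hX
    obtain ⟨hX, hyX⟩ := Finset.mem_filter.1 hX
    refine mem_star14.2 ⟨(hA X hX).1, (hA X hX).2, ?_⟩
    exact Finset.insert_subset (hIX X hX hzI) (Finset.insert_subset hyX (hT0.trans (hIX X hX)))
  have hK' := hK T hTc z hzT
  set h := (star14 H s T).card with hh
  have h2A : 2 * A.card ≤ h := by
    calc 2 * A.card ≤ 2 * (s * (star14 H r (insert z T)).card) := by
          apply Nat.mul_le_mul_left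
          exact hAle.trans (Nat.mul_le_mul_left _ ha)
      _ = (2 * s) * (star14 H r (insert z T)).card := by ring
      _ ≤ (N + 1) * (star14 H r (insert z T)).card := Nat.mul_le_mul_right _ hNs
      _ ≤ h := hK'
  have hpos : 0 < h := by omega
  set W := (A1 ∪ A2) \ T with hW
  have hWc : W.card ≤ 2 * (r - t) := by
    have h1 : (A1 ∩ A2).card + (A1 ∪ A2).card = A1.card + A2.card := Finset.card_inter_add_card_union _ _
    have h2 : I ⊆ A1 ∩ A2 := Finset.subset_inter (hIX A1 hA1) (hIX A2 hA2)
    have h3 := Finset.card_le_card h2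
    have h4 := (hA A1 hA1).2
    have h5 := (hA A2 hA2).2
    rw [hW, Finset.card_sdiff_of_subset (hTA1.trans Finset.subset_union_left)]
    omega
  set B1 := H.filter (fun S => S.card = s ∧ t ≤ (S ∩ A1).card) with hB1
  have hBB1 : B ⊆ B1 := by
    intro X hX
    refine Finset.mem_filter.2 ⟨(hB X hX).1, (hB X hX).2, ?_⟩
    rw [Finset.inter_comm]
    exact hcross A1 hA1 X hX
  have hsub : star14 H s T ⊆ (B1 \ B) ∪ W.biUnion (fun w => star14 H s (insert w T)) := by
    intro X hX
    obtain ⟨hXH, hXc, hTX⟩ := mem_star14.1 hX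
    by_cases hw : ∃ w ∈ W, w ∈ X
    · obtain ⟨w, hw, hwX⟩ := hw
      apply Finset.mem_union_right
      exact Finset.mem_biUnion.2 ⟨w, hw, mem_star14.2 ⟨hXH, hXc, Finset.insert_subset hwX hTX⟩⟩
    · push Not at hw
      apply Finset.mem_union_left
      refine Finset.mem_sdiff.2 ⟨Finset.mem_filter.2 ⟨hXH, hXc, ?_⟩, ?_⟩
      · rw [← hTc]; exact Finset.card_le_card (Finset.subset_inter hTX hTA1)
      · intro hXB
        have h1 := hcross A2 hA2 X hXB
        have h2 : A2 ∩ X ⊆ T0 := by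
          intro x hx
          rw [Finset.mem_inter] at hx
          by_contra hxT
          refine hw x (Finset.mem_sdiff.2 ⟨Finset.mem_union_right _ hx.1, ?_⟩) hx.2
          intro h3
          rcases Finset.mem_insert.1 h3 with h3 | h3
          · exact hyA2 (h3 ▸ hx.1)
          · exact hxT h3
        have := Finset.card_le_card h2
        omega
  set E := (W.biUnion (fun w => star14 H s (insert w T))).card with hEdef
  have hc : h ≤ (B1 \ B).card + E := (Finset.card_le_card hsub).trans (Finset.card_union_le _ _)
  have hE2 : 2 * E ≤ h := by
    have h1 : N * E ≤ 2 * (r - t) * h := by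
      calc N * E ≤ N * ∑ w ∈ W, (star14 H s (insert w T)).card :=
            Nat.mul_le_mul_left _ Finset.card_biUnion_le
        _ = ∑ w ∈ W, N * (star14 H s (insert w T)).card := Finset.mul_sum _ _ _
        _ ≤ ∑ w ∈ W, h := by
            apply Finset.sum_le_sum
            intro w hw
            exact (hE T hTc hpos w (Finset.mem_sdiff.1 hw).2).le
        _ = W.card * h := by rw [Finset.sum_const, smul_eq_mul]
        _ ≤ _ := Nat.mul_le_mul_right _ hWc
    have h2 := (Nat.mul_le_mul_right E hN).trans h1
    have h3 : 0 < 2 * (r - t) := by omega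
    apply Nat.le_of_mul_le_mul_left _ h3
    calc _ = 4 * (r - t) * E := by ring
      _ ≤ _ := h2
  have hm := hmax A1 hA1
  have hd : (B1 \ B).card + B.card = B1.card := Finset.card_sdiff_add_card_eq_card hBB1
  have hm' : 1 + B1.card ≤ A.card + B.card := hm
  omega

theorem core14 {α : Type*} [DecidableEq α] (t r s : ℕ)
    (ht : 1 ≤ t) (htr : t ≤ r) (hrs : r ≤ s)
    (H : Finset (Finset α)) (hH : Hereditary H) (hmu : cBound r s t ≤ mu H)
    (A B : Finset (Finset α)) (hAne : A.Nonempty) (hBne : B.Nonempty)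
    (hA : A ⊆ H.filter (fun A' => A'.card = r))
    (hB : B ⊆ H.filter (fun B' => B'.card = s))
    (hcross : ∀ A' ∈ A, ∀ B' ∈ B, t ≤ (A' ∩ B').card)
    (hmax : ∀ A' B' : Finset (Finset α), A'.Nonempty → B'.Nonempty →
      A' ⊆ H.filter (fun C => C.card = r) → B' ⊆ H.filter (fun C => C.card = s) →
      (∀ A₀ ∈ A', ∀ B₀ ∈ B', t ≤ (A₀ ∩ B₀).card) →
      A'.card + B'.card ≤ A.card + B.card)
    (hAB : r < s ∨ A.card ≤ B.card) :
    ∃ I ∈ H, t ≤ I.card ∧ I.card ≤ r ∧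
      (A = H.filter (fun A' => A'.card = r ∧ I ⊆ A') ∧
          B = H.filter (fun B' => B'.card = s ∧ t ≤ (B' ∩ I).card)) := by
  have hA' : ∀ X ∈ A, X ∈ H ∧ X.card = r := fun X hX => Finset.mem_filter.1 (hA hX)
  have hB' : ∀ X ∈ B, X ∈ H ∧ X.card = s := fun X hX => Finset.mem_filter.1 (hB hX)
  obtain ⟨A1, hA1⟩ := hAne
  obtain ⟨B1, hB1⟩ := hBne
  -- finishing
  have fin : ∀ I : Finset α, (∀ X ∈ A, I ⊆ X) → t ≤ I.card → (∀ S ∈ B, t ≤ (S ∩ I).card) →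
      ∃ I ∈ H, t ≤ I.card ∧ I.card ≤ r ∧
      (A = H.filter (fun A' => A'.card = r ∧ I ⊆ A') ∧
          B = H.filter (fun B' => B'.card = s ∧ t ≤ (B' ∩ I).card)) := by
    intro I hI hIt hS
    have hIA1 := hI A1 hA1
    refine ⟨I, hH A1 (hA' A1 hA1).1 I hIA1, hIt, ?_, ?_⟩
    · rw [← (hA' A1 hA1).2]; exact Finset.card_le_card hIA1
    have sA : A ⊆ H.filter (fun A' => A'.card = r ∧ I ⊆ A') := fun X hX =>
      Finset.mem_filter.2 ⟨(hA' X hX).1, (hA' X hX).2, hI X hX⟩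
    have sB : B ⊆ H.filter (fun B' => B'.card = s ∧ t ≤ (B' ∩ I).card) := fun X hX =>
      Finset.mem_filter.2 ⟨(hB' X hX).1, (hB' X hX).2, hS X hX⟩
    have h := hmax _ _ ⟨A1, sA hA1⟩ ⟨B1, sB hB1⟩
      (fun X hX => by
        have := Finset.mem_filter.1 hX
        exact Finset.mem_filter.2 ⟨this.1, this.2.1⟩)
      (fun X hX => by
        have := Finset.mem_filter.1 hX
        exact Finset.mem_filter.2 ⟨this.1, this.2.1⟩)
      (fun X hX Y hY => by
        have h1 := (Finset.mem_filter.1 hX).2.2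
        have h2 := (Finset.mem_filter.1 hY).2.2
        refine h2.trans (Finset.card_le_card ?_)
        intro x hx
        rw [Finset.mem_inter] at hx ⊢
        exact ⟨h1 hx.2, hx.1⟩)
    have cA := Finset.card_le_card sA
    have cB := Finset.card_le_card sB
    exact ⟨Finset.eq_of_subset_of_card_le sA (by omega),
      Finset.eq_of_subset_of_card_le sB (by omega)⟩
  have hAB1 : ∀ X ∈ A, ∀ Y ∈ B, t = s → X = Y := by
    intro X hX Y hY hts
    have h1 := hcross X hX Y hY
    have h2 := (hA' X hX).2
    have h3 := (hB' Y hY).2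
    have e1 : X ∩ Y = X := Finset.eq_of_subset_of_card_le Finset.inter_subset_left (by omega)
    have e2 : X ∩ Y = Y := Finset.eq_of_subset_of_card_le Finset.inter_subset_right (by omega)
    rw [← e1, e2]
  rcases Nat.eq_or_lt_of_le (htr.trans hrs) with hts | hts
  · apply fin B1
    · intro X hX; rw [hAB1 X hX B1 hB1 hts]
    · rw [(hB' B1 hB1).2]; omega
    · intro S hS
      rw [← hAB1 A1 hA1 S hS hts, ← hAB1 A1 hA1 B1 hB1 hts, Finset.inter_self, (hA' A1 hA1).2]
      exact htr
  -- numbers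
  unfold cBound at hmu
  have hM1 := le_max_left (2 * Nat.choose s t) (2 ^ r * (r - t) * Nat.choose r t + 1)
  have hM2 := le_max_right (2 * Nat.choose s t) (2 ^ r * (r - t) * Nat.choose r t + 1)
  set M := max (2 * Nat.choose s t) (2 ^ r * (r - t) * Nat.choose r t + 1) with hMdef
  have hsc : s ≤ s.choose t := ch14 s t ht hts
  have hrc : 0 < r.choose t := Nat.choose_pos htr
  obtain ⟨N, hN⟩ : ∃ N, M = N + 1 := ⟨M - 1, by omega⟩
  have hNr : t < r → 4 * ((r - t) * r.choose t) ≤ N := by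
    intro h
    have h4 : 2 ^ 2 ≤ 2 ^ r := Nat.pow_le_pow_right (by norm_num) (by omega)
    calc 4 * ((r - t) * r.choose t) ≤ 2 ^ r * ((r - t) * r.choose t) :=
          Nat.mul_le_mul_right _ h4
      _ = 2 ^ r * (r - t) * r.choose t := by ring
      _ ≤ N := by omega
  have hN1 : 2 * (r.choose t * (r - t + 1)) ≤ N := by
    rcases Nat.eq_or_lt_of_le htr with h | h
    · subst h; simp; omega
    · refine le_trans ?_ (hNr h)
      obtain ⟨d, hd⟩ : ∃ d, r - t = d + 1 := ⟨r - t - 1, by omega⟩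
      rw [hd]
      nlinarith
  have hN2 : 2 * s ≤ N + 1 := by omega
  have hM2' : 2 ≤ M := by omega
  -- largest star
  obtain ⟨T1, hT1, hT1c⟩ := Finset.exists_subset_card_eq (s := B1) (n := t)
    (by rw [(hB' B1 hB1).2]; omega)
  have hT1H : T1 ∈ H := hH B1 (hB' B1 hB1).1 T1 hT1
  obtain ⟨T2, hT2, hT2max⟩ := Finset.exists_max_image (H.filter (fun T => T.card = t))
    (fun T => (star14 H s T).card) ⟨T1, Finset.mem_filter.2 ⟨hT1H, hT1c⟩⟩
  obtain ⟨hT2H, hT2c⟩ := Finset.mem_filter.1 hT2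
  set m := (star14 H s T2).card with hm
  have hmT : ∀ T : Finset α, T.card = t → (star14 H s T).card ≤ m := by
    intro T hT
    by_cases h : T ∈ H
    · exact hT2max T (Finset.mem_filter.2 ⟨h, hT⟩)
    · have : star14 H s T = ∅ := by
        apply Finset.eq_empty_of_forall_notMem
        intro X hX
        obtain ⟨h1, _, h3⟩ := mem_star14.1 hX
        exact h (hH X h1 T h3)
      rw [this]; simp
  have hmpos : 0 < m := by
    refine lt_of_lt_of_le ?_ (hmT T1 hT1c)
    exact Finset.card_pos.2 ⟨B1, mem_star14.2 ⟨(hB' B1 hB1).1, (hB' B1 hB1).2, hT1⟩⟩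
  have hE : ∀ T : Finset α, T.card = t → 0 < (star14 H s T).card → ∀ z ∉ T,
      N * (star14 H s (insert z T)).card < (star14 H s T).card := by
    intro T hT hp z hz
    exact E14 H hH t r s N htr hts (by rw [← hN]; exact hmu) T hT z hz hp
  have hE' : ∀ T : Finset α, T.card = t → ∀ z ∉ T,
      N * (star14 H s (insert z T)).card < m := by
    intro T hT z hz
    rcases Nat.eq_zero_or_pos (star14 H s T).card with h0 | hp
    · have : (star14 H s (insert z T)).card ≤ (star14 H s T).card := by
        apply Finset.card_le_card
        intro X hX
        obtain ⟨h1, h2, h3⟩ := mem_star14.1 hX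
        exact mem_star14.2 ⟨h1, h2, (Finset.subset_insert _ _).trans h3⟩
      have h00 : (star14 H s (insert z T)).card = 0 := by omega
      rw [h00]; simpa using hmpos
    · exact lt_of_lt_of_le (hE T hT hp z hz) (hmT T hT)
  have hK : ∀ T : Finset α, T.card = t → ∀ z ∉ T,
      (N + 1) * (star14 H r (insert z T)).card ≤ (star14 H s T).card := by
    intro T hT z hz
    obtain ⟨k, hk⟩ : ∃ k, r = k + 1 := ⟨r - 1, by omega⟩
    have h1 := er14 H hH k T z hz
    rw [← hk] at h1
    refine (Nat.mul_le_mul_left _ h1).trans ?_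
    rw [← hN]
    exact K14 H hH t r s M htr hts hM2' hmu T hT k (by omega) (by omega)
  have hstar : (star14 H r T2).card + m ≤ A.card + B.card := by
    obtain ⟨X, hX⟩ : (star14 H s T2).Nonempty := Finset.card_pos.1 hmpos
    obtain ⟨hXH, hXc, hTX⟩ := mem_star14.1 hX
    obtain ⟨Z, hTZ, hZX, hZc⟩ := Finset.exists_subsuperset_card_eq hTX
      (n := r) (by omega) (by omega)
    refine hmax (star14 H r T2) (star14 H s T2) ⟨Z, mem_star14.2 ⟨hH X hXH Z hZX, hZc, hTZ⟩⟩
      ⟨X, hX⟩ ?_ ?_ ?_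
    · intro Y hY
      obtain ⟨h1, h2, _⟩ := mem_star14.1 hY
      exact Finset.mem_filter.2 ⟨h1, h2⟩
    · intro Y hY
      obtain ⟨h1, h2, _⟩ := mem_star14.1 hY
      exact Finset.mem_filter.2 ⟨h1, h2⟩
    · intro Y hY Y' hY'
      rw [← hT2c]
      exact Finset.card_le_card (Finset.subset_inter (mem_star14.1 hY).2.2 (mem_star14.1 hY').2.2)
  have hBm : m ≤ 2 * B.card := by
    rcases Nat.eq_or_lt_of_le hrs with h | h
    · have : A.card ≤ B.card := by
        rcases hAB with h' | h'
        · omega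
        · exact h'
      omega
    · have hcov : A ⊆ (B1.powersetCard t).biUnion (fun T => star14 H r T) := by
        intro X hX
        obtain ⟨T, hT, hTc⟩ := Finset.exists_subset_card_eq (hcross X hX B1 hB1)
        exact Finset.mem_biUnion.2 ⟨T, Finset.mem_powersetCard.2
          ⟨hT.trans Finset.inter_subset_right, hTc⟩, mem_star14.2 ⟨(hA' X hX).1, (hA' X hX).2,
          hT.trans Finset.inter_subset_left⟩⟩
      have h1 : M * A.card ≤ s.choose t * m := by
        calc M * A.card ≤ M * ∑ T ∈ B1.powersetCard t, (star14 H r T).card :=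
              Nat.mul_le_mul_left _ ((Finset.card_le_card hcov).trans Finset.card_biUnion_le)
          _ = ∑ T ∈ B1.powersetCard t, M * (star14 H r T).card := Finset.mul_sum _ _ _
          _ ≤ ∑ T ∈ B1.powersetCard t, m := by
              apply Finset.sum_le_sum
              intro T hT
              have hTc := (Finset.mem_powersetCard.1 hT).2
              exact (K14 H hH t r s M htr hts hM2' hmu T hTc r le_rfl h).trans (hmT T hTc)
          _ = _ := by
              rw [Finset.sum_const, Finset.card_powersetCard, (hB' B1 hB1).2, smul_eq_mul]
      have h2 := (Nat.mul_le_mul_right A.card hM1).trans h1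
      have h3 : 2 * A.card ≤ m := by
        apply Nat.le_of_mul_le_mul_left (c := s.choose t) _ (by omega)
        calc _ = 2 * s.choose t * A.card := by ring
          _ ≤ _ := h2
      omega
  obtain ⟨T, hTc, hTA⟩ := step1_14 t r s N m htr H A B hA' hB' hcross hN1 hE' hBm A1 hA1
  set I := A1.filter (fun x => ∀ X ∈ A, x ∈ X) with hIdef
  have hI : ∀ x, x ∈ I ↔ ∀ X ∈ A, x ∈ X := by
    intro x
    rw [hIdef, Finset.mem_filter]
    exact ⟨fun h => h.2, fun h => ⟨h A1 hA1, h⟩⟩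
  have hIt : t ≤ I.card := by
    rw [← hTc]
    apply Finset.card_le_card
    intro x hx
    exact (hI x).2 (fun X hX => hTA X hX hx)
  have hIX : ∀ X ∈ A, I ⊆ X := fun X hX x hx => (hI x).1 hx X hX
  refine fin I hIX hIt ?_
  rcases Nat.eq_or_lt_of_le htr with h | h
  · intro S hS
    have : I = A1 := Finset.eq_of_subset_of_card_le (hIX A1 hA1) (by rw [(hA' A1 hA1).2]; omega)
    rw [this, Finset.inter_comm]
    exact hcross A1 hA1 S hS
  · refine step2_14 t r s N ht h H A B ⟨A1, hA1⟩ hA' hB' hcross ?_ hN2 hE hK ?_ I hI hIt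
    · refine le_trans ?_ (hNr h)
      nlinarith
    · intro X hX
      have := hmax {X} (H.filter (fun S => S.card = s ∧ t ≤ (S ∩ X).card)) ⟨X, by simp⟩
        ⟨B1, Finset.mem_filter.2 ⟨(hB' B1 hB1).1, (hB' B1 hB1).2, by
          rw [Finset.inter_comm]; exact hcross X hX B1 hB1⟩⟩
        (by intro Y hY; rw [Finset.mem_singleton] at hY; rw [hY]; exact hA hX)
        (by
          intro Y hY
          have := Finset.mem_filter.1 hY
          exact Finset.mem_filter.2 ⟨this.1, this.2.1⟩)
        (by
          intro Y hY Z hZ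
          rw [Finset.mem_singleton] at hY
          rw [hY, Finset.inter_comm]
          exact (Finset.mem_filter.1 hZ).2.2)
      simpa using this

theorem stmt_14 {α : Type*} [DecidableEq α] (t r s : ℕ)
    (ht : 1 ≤ t) (htr : t ≤ r) (hrs : r ≤ s)
    (H : Finset (Finset α)) (hH : Hereditary H) (hmu : cBound r s t ≤ mu H)
    (A B : Finset (Finset α)) (hAne : A.Nonempty) (hBne : B.Nonempty)
    (hA : A ⊆ H.filter (fun A' => A'.card = r))
    (hB : B ⊆ H.filter (fun B' => B'.card = s))
    (hcross : ∀ A' ∈ A, ∀ B' ∈ B, t ≤ (A' ∩ B').card)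
    (hmax : ∀ A' B' : Finset (Finset α), A'.Nonempty → B'.Nonempty →
      A' ⊆ H.filter (fun C => C.card = r) → B' ⊆ H.filter (fun C => C.card = s) →
      (∀ A₀ ∈ A', ∀ B₀ ∈ B', t ≤ (A₀ ∩ B₀).card) →
      A'.card + B'.card ≤ A.card + B.card) :
    ∃ I ∈ H, t ≤ I.card ∧ I.card ≤ r ∧
      ((A = H.filter (fun A' => A'.card = r ∧ I ⊆ A') ∧
          B = H.filter (fun B' => B'.card = s ∧ t ≤ (B' ∩ I).card)) ∨
        (r = s ∧ t < I.card ∧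
          A = H.filter (fun A' => A'.card = r ∧ t ≤ (A' ∩ I).card) ∧
          B = H.filter (fun B' => B'.card = s ∧ I ⊆ B'))) := by
  by_cases hAB : r < s ∨ A.card ≤ B.card
  · obtain ⟨I, hI, h1, h2, h3⟩ := core14 t r s ht htr hrs H hH hmu A B hAne hBne hA hB hcross hmax hAB
    exact ⟨I, hI, h1, h2, Or.inl h3⟩
  · push Not at hAB
    obtain rfl : r = s := le_antisymm hrs hAB.1
    obtain ⟨I, hI, h1, h2, h3, h4⟩ := core14 t r r ht htr hrs H hH hmu B A hBne hAne hB hA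
      (fun X hX Y hY => by rw [Finset.inter_comm]; exact hcross Y hY X hX)
      (fun A' B' hA1 hB1 hA2 hB2 hc => by
        have := hmax B' A' hB1 hA1 hB2 hA2
          (fun X hX Y hY => by rw [Finset.inter_comm]; exact hc Y hY X hX)
        omega) (Or.inr hAB.2.le)
    refine ⟨I, hI, h1, h2, ?_⟩
    rcases Nat.eq_or_lt_of_le h1 with h | h
    · left
      have key : ∀ X : Finset α, t ≤ (X ∩ I).card ↔ I ⊆ X := by
        intro X
        constructor
        · intro hX
          have : X ∩ I = I := Finset.eq_of_subset_of_card_le Finset.inter_subset_right (by omega)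
          rw [← this]; exact Finset.inter_subset_left
        · intro hX
          rw [Finset.inter_eq_right.2 hX]; exact h1
      rw [h3, h4]
      simp only [key, and_self]
    · right
      exact ⟨rfl, h, h4, h3⟩
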